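/- Suppose f : [0,∞) → ℝ is twice continuously differentiable, satisfies f''(x) = f(x)² − P for all x ≥ 0, and f'(0) > 0. If either P < 0, or P ≥ 0 and f(0) > √P, then f is not bounded above on [0,∞): for every M ∈ ℝ there exists x ≥ 0 with f(x) > M. -/

import Mathlib

open Set Filter

theorem le_of_hasDerivWithinAt_Ici_nonneg {h h' : ℝ → ℝ} {a t : ℝ} (hat : a ≤ t)
    (hd : ∀ x ∈ Ici a, HasDerivWithinAt h (h' x) (Ici a) x)
    (hn : ∀ x ∈ Ioo a t, 0 ≤ h' x) : h a ≤ h t := by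
  have hsub : Icc a t ⊆ Ici a := Icc_subset_Ici_self
  have hmono : MonotoneOn h (Icc a t) := by
    refine monotoneOn_of_hasDerivWithinAt_nonneg (f' := h') (convex_Icc a t)
      (fun x hx => ((hd x (hsub hx)).mono hsub).continuousWithinAt) (fun x hx => ?_)
      (fun x hx => hn x (by rwa [interior_Icc] at hx))
    exact (hd x (hsub (interior_subset hx))).mono (interior_subset.trans hsub)
  exact hmono (left_mem_Icc.2 hat) (right_mem_Icc.2 hat) hat

/-- If `f : [0,∞) → ℝ` is twice continuously differentiable, solves
`f'' = f² − P` on `[0,∞)`, has `f'(0) > 0`, and either `P < 0`, or `P ≥ 0` and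
`f(0) > √P`, then `f` is not bounded above on `[0,∞)`. -/
theorem stmt4 (P : ℝ) (f f' : ℝ → ℝ)
    (hf : ∀ x ∈ Ici (0:ℝ), HasDerivWithinAt f (f' x) (Ici 0) x)
    (hf' : ∀ x ∈ Ici (0:ℝ), HasDerivWithinAt f' (f x ^ 2 - P) (Ici 0) x)
    (h0 : 0 < f' 0)
    (hcase : P < 0 ∨ (0 ≤ P ∧ Real.sqrt P < f 0)) :
    ∀ M : ℝ, ∃ x : ℝ, 0 ≤ x ∧ M < f x := by
  have hsq : ∀ y, f 0 ≤ y → 0 ≤ y ^ 2 - P := by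
    intro y hy
    rcases hcase with hP | ⟨hP, hlt⟩
    · nlinarith [sq_nonneg y]
    · nlinarith [Real.sq_sqrt hP, Real.sqrt_nonneg P]
  have hstep : ∀ t, 0 ≤ t → (∀ x ∈ Ico 0 t, 0 < f' x) → f' 0 ≤ f' t := by
    intro t ht hpos
    refine le_of_hasDerivWithinAt_Ici_nonneg ht hf' fun x hx => hsq _ ?_
    exact le_of_hasDerivWithinAt_Ici_nonneg hx.1.le hf fun y hy =>
      (hpos y ⟨hy.1.le, hy.2.trans hx.2⟩).le
  have hpos : ∀ x, 0 ≤ x → 0 < f' x := by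
    by_contra! hneg
    obtain ⟨b, hb, hfb⟩ := hneg
    have hcont : ContinuousOn f' (Ici 0) := fun x hx => (hf' x hx).continuousWithinAt
    have hclosed : IsClosed (Ici 0 ∩ f' ⁻¹' Iic 0) :=
      hcont.preimage_isClosed_of_isClosed isClosed_Ici isClosed_Iic
    have hbdd : BddBelow (Ici 0 ∩ f' ⁻¹' Iic 0) := ⟨0, fun x hx => hx.1⟩
    obtain ⟨ht, hft⟩ := hclosed.csInf_mem ⟨b, hb, hfb⟩ hbdd
    have hle := hstep _ ht fun x hx => by
      by_contra! hx'
      exact hx.2.not_ge (csInf_le hbdd ⟨hx.1, hx'⟩)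
    exact absurd hft (not_le.2 (h0.trans_le hle))
  have hlin : ∀ x, 0 ≤ x → f 0 + f' 0 * x ≤ f x := by
    intro x hx
    have := le_of_hasDerivWithinAt_Ici_nonneg (h := fun y => f y - f' 0 * y)
      (h' := fun y => f' y - f' 0 * 1) hx
      (fun y hy => (hf y hy).sub ((hasDerivWithinAt_id y _).const_mul (f' 0)))
      (fun y hy => by linarith [hstep y hy.1.le fun z hz => hpos z hz.1])
    simp only [mul_zero, sub_zero] at this
    linarith
  intro M
  have hx : 0 ≤ (|M - f 0| + 1) / f' 0 := by positivity
  refine ⟨_, hx, ?_⟩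
  have := hlin _ hx
  rw [mul_div_cancel₀ _ h0.ne'] at this
  linarith [le_abs_self (M - f 0)]
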